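/- Let m be a square-free positive integer with m ≡ 2 (mod 4), let θ = m^(1/4) be the real positive fourth root of m, and let K = ℚ(i, θ). Then the discriminant of the number field K equals 2^18 · m^6. -/

import Mathlib

open NumberField

/-- The real positive fourth root of `m`, viewed as a complex number. -/
noncomputable def theta (m : ℕ) : ℂ := ((m : ℝ) ^ ((1 : ℝ) / 4) : ℝ)

/-- The octic field `K = ℚ(i, m^(1/4))` as a subfield of `ℂ`. -/
noncomputable def Kfield (m : ℕ) : IntermediateField ℚ ℂ :=
  IntermediateField.adjoin ℚ {Complex.I, theta m}

namespace GaussianInt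

/-- The imaginary unit of `ℤ[i]`. -/
def I : GaussianInt := ⟨0, 1⟩

lemma I_mul_I : I * I = -1 := by decide

/-- Reduction of a Gaussian integer modulo the prime `1 - i`. -/
def parity : GaussianInt →+* ZMod 2 := Zsqrtd.lift ⟨1, by decide⟩

lemma parity_I : parity I = 1 := by decide

lemma exists_eq_mul_of_parity_eq_zero {z : GaussianInt} (h : parity z = 0) :
    ∃ w, z = (1 - I) * w := by
  have h' : ((z.re + z.im : ℤ) : ZMod 2) = 0 := by
    simpa [parity] using h
  obtain ⟨k, hk⟩ := (ZMod.intCast_zmod_eq_zero_iff_dvd _ 2).1 h'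
  refine ⟨⟨z.re - k, k⟩, ?_⟩
  ext
  · simp [I]
  · simp [I]
    push_cast at hk
    linarith

lemma one_sub_I_ne_zero : (1 - I : GaussianInt) ≠ 0 := by decide

lemma sq_zmod_two (x : ZMod 2) : x ^ 2 = x := by revert x; decide

/-- The congruence `(1 - i) A² ≡ φ B² mod 2 (1 - i)` in `ℤ[i][φ]`, `φ² = i n`, forces divisibility. -/
lemma descent {n : ℤ} (hn : Odd n) {a₀ a₁ b₀ b₁ r s : GaussianInt}
    (h₁ : (1 - I) * (a₀ ^ 2 + I * n * a₁ ^ 2) - 2 * I * n * b₀ * b₁ = 2 * (1 - I) * r)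
    (h₂ : 2 * (1 - I) * a₀ * a₁ - (b₀ ^ 2 + I * n * b₁ ^ 2) = 2 * (1 - I) * s) :
    ∃ a₀' a₁' b d, a₀ = (1 - I) * a₀' ∧ a₁ = (1 - I) * a₁' ∧ b₀ = (1 - I) * (b + (1 - I) * d) ∧
      b₁ = (1 - I) * b := by
  obtain ⟨k, rfl⟩ := hn
  have hI := I_mul_I
  have hP := one_sub_I_ne_zero
  have eI := parity_I
  have key : ∀ {z w : GaussianInt}, (1 - I) * z = (1 - I) * w → z = w :=
    fun h => mul_left_cancel₀ hP h
  push_cast at h₁ h₂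
  obtain ⟨d, hd⟩ : ∃ d, b₀ - b₁ = (1 - I) * d := by
    apply exists_eq_mul_of_parity_eq_zero
    have := congrArg parity h₂
    simp only [map_sub, map_add, map_mul, map_pow, map_one, map_ofNat, map_intCast, eI,
      sq_zmod_two] at this
    simp only [map_sub]
    have two : (2 : ZMod 2) = 0 := by decide
    linear_combination this + (parity b₀ + k * parity b₁) * two
  obtain rfl : b₀ = b₁ + (1 - I) * d := by linear_combination hd
  have h₁' : a₀ ^ 2 + I * (2 * k + 1) * a₁ ^ 2
      + (1 - I) * (2 * k + 1) * (b₁ + (1 - I) * d) * b₁ = 2 * r := by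
    exact key (by linear_combination h₁ + (2 * b₁ * d * k + b₁ * d + 2 * b₁ ^ 2 * k
      - 2 * I * b₁ * d * k + b₁ ^ 2 - I * b₁ * d) * hI)
  have h₂' : 2 * a₀ * a₁ - ((I - k * (1 - I)) * b₁ ^ 2 + 2 * b₁ * d + (1 - I) * d ^ 2) = 2 * s := by
    exact key (by linear_combination h₂ + (b₁ ^ 2 + b₁ ^ 2 * k) * hI)
  obtain ⟨b, rfl⟩ : ∃ b, b₁ = (1 - I) * b := by
    apply exists_eq_mul_of_parity_eq_zero
    have := congrArg parity h₂'
    simp only [map_sub, map_add, map_mul, map_pow, map_one, map_ofNat, map_intCast, eI,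
      sq_zmod_two] at this
    have two : (2 : ZMod 2) = 0 := by decide
    linear_combination -this + (parity a₀ * parity a₁ - parity b₁ * parity d - parity s) * two
  obtain ⟨e, he⟩ : ∃ e, a₀ - a₁ = (1 - I) * e := by
    apply exists_eq_mul_of_parity_eq_zero
    have := congrArg parity h₁'
    simp only [map_sub, map_add, map_mul, map_pow, map_one, map_ofNat, map_intCast, eI,
      sq_zmod_two] at this
    simp only [map_sub]
    have two : (2 : ZMod 2) = 0 := by decide
    linear_combination this + (parity r - parity a₁ - k * parity a₁) * two
  obtain rfl : a₀ = a₁ + (1 - I) * e := by linear_combination he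
  have h₁'' : (I - k * (1 - I)) * a₁ ^ 2 + 2 * e * a₁ + (1 - I) * e ^ 2
      + (2 * k + 1) * ((1 - I) * (b + d)) * ((1 - I) * b) = I * (1 - I) * r := by
    exact key (by linear_combination h₁' + (2 * r - a₁ ^ 2 - a₁ ^ 2 * k - I * r) * hI)
  obtain ⟨a, rfl⟩ : ∃ a, a₁ = (1 - I) * a := by
    apply exists_eq_mul_of_parity_eq_zero
    have := congrArg parity h₁''
    simp only [map_sub, map_add, map_mul, map_pow, map_one, map_ofNat, map_intCast, eI,
      sq_zmod_two] at this
    have two : (2 : ZMod 2) = 0 := by decide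
    linear_combination this - parity e * parity a₁ * two
  have h₂'' : 2 * (1 - I) * (a + e) * a - ((I - k * (1 - I)) * (1 - I) * b ^ 2 + 2 * b * d + d ^ 2)
      = I * (1 - I) * s := by
    exact key (by linear_combination h₂' + (2 * s - I * s) * hI)
  obtain ⟨d, rfl⟩ : ∃ d', d = (1 - I) * d' := by
    apply exists_eq_mul_of_parity_eq_zero
    have := congrArg parity h₂''
    simp only [map_sub, map_add, map_mul, map_pow, map_one, map_ofNat, map_intCast, eI,
      sq_zmod_two] at this
    have two : (2 : ZMod 2) = 0 := by decide
    linear_combination -this - parity b * parity d * two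
  exact ⟨a + e, a, b, d, by ring, rfl, by ring, rfl⟩

/-- The congruence `(1 - i) A² ≡ φ B² mod 4 (1 - i)` in `ℤ[i][φ]`, `φ² = i n`, forces `A` to be
divisible by `2` and `B` to be divisible by `2 (1 + φ)`. -/
lemma two_dvd_of_congr {n : ℤ} (hn : Odd n) {a₀ a₁ b₀ b₁ r s : GaussianInt}
    (h₁ : (1 - I) * (a₀ ^ 2 + I * n * a₁ ^ 2) - 2 * I * n * b₀ * b₁ = 4 * (1 - I) * r)
    (h₂ : 2 * (1 - I) * a₀ * a₁ - (b₀ ^ 2 + I * n * b₁ ^ 2) = 4 * (1 - I) * s) :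
    ∃ a₀' a₁' b d, a₀ = 2 * a₀' ∧ a₁ = 2 * a₁' ∧ b₀ = 2 * (b + (1 - I) * d) ∧
      b₁ = 2 * b := by
  have hI := I_mul_I
  have key : ∀ {z w : GaussianInt}, (1 - I) ^ 2 * z = (1 - I) ^ 2 * w → z = w :=
    fun h => mul_left_cancel₀ (pow_ne_zero 2 one_sub_I_ne_zero) h
  obtain ⟨x₀, x₁, y, e, rfl, rfl, rfl, rfl⟩ :=
    descent hn (a₀ := a₀) (a₁ := a₁) (b₀ := b₀) (b₁ := b₁) (r := 2 * r) (s := 2 * s)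
      (by linear_combination h₁) (by linear_combination h₂)
  obtain ⟨u₀, u₁, b, d, rfl, rfl, hd, rfl⟩ := descent hn (a₀ := x₀) (a₁ := x₁)
    (b₀ := y + (1 - I) * e) (b₁ := y) (r := I * r) (s := I * s)
    (key (by linear_combination h₁ + (4 * r - 6 * I * r + 2 * I ^ 2 * r) * hI))
    (key (by linear_combination h₂ + (4 * s - 6 * I * s + 2 * I ^ 2 * s) * hI))
  exact ⟨-I * u₀, -I * u₁, -I * b, -I * d, by linear_combination u₀ * hI,
    by linear_combination u₁ * hI, by linear_combination (1 - I) * hd + (d + b - I * d) * hI,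
    by linear_combination b * hI⟩

end GaussianInt

namespace QuadraticAlgebra

lemma isIntegral_trace_and_norm {F : Type*} [CommRing F] {a : F} {z : QuadraticAlgebra F a 0}
    (hz : IsIntegral ℤ z) :
    IsIntegral ℤ (2 * z.re) ∧ IsIntegral ℤ (z.re ^ 2 - a * z.im ^ 2) := by
  have hs : IsIntegral ℤ (star z) :=
    map_isIntegral_int (starRingEnd (QuadraticAlgebra F a 0)) hz
  have inj : Function.Injective (algebraMap F (QuadraticAlgebra F a 0)) := algebraMap_injective
  constructor
  · rw [← isIntegral_algebraMap_iff (B := QuadraticAlgebra F a 0) inj]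
    convert hz.add hs using 1
    rw [← algebraMap_trace_eq_add_star, trace_def]
    simp
  · rw [← isIntegral_algebraMap_iff (B := QuadraticAlgebra F a 0) inj]
    convert hz.mul hs using 1
    rw [← algebraMap_norm_eq_mul_star, norm_def]
    congr 1
    ring

lemma trace_eq_two_mul_re {F : Type*} [CommRing F] {a : F} (z : QuadraticAlgebra F a 0) :
    Algebra.trace F (QuadraticAlgebra F a 0) z = 2 * z.re := by
  rw [Algebra.trace_eq_matrix_trace (basis a 0)]
  simp [Matrix.trace, Algebra.leftMulMatrix_eq_repr_mul, basis]
  ring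

end QuadraticAlgebra

/-- `ℚ(i)`. -/
abbrev GaussField := QuadraticAlgebra ℚ (-1) 0

instance : Fact (∀ r : ℚ, r ^ 2 ≠ -1 + 0 * r) := ⟨fun r h => by nlinarith [sq_nonneg r]⟩

namespace GaussField

lemma not_sq {n : ℤ} (hn : Odd n) (r : GaussField) : r ^ 2 ≠ (⟨0, n⟩ : GaussField) + 0 * r := by
  intro h
  have h₁ := congrArg QuadraticAlgebra.re h
  have h₂ := congrArg QuadraticAlgebra.im h
  simp [sq] at h₁ h₂
  have h₃ : (n : ℚ) = 2 * r.re ^ 2 ∨ (n : ℚ) = - (2 * r.re ^ 2) := by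
    have : (r.re - r.im) * (r.re + r.im) = 0 := by linear_combination h₁
    rcases mul_eq_zero.1 this with h | h
    · left; rw [← sub_eq_zero.1 h] at h₂; linarith
    · right; rw [eq_neg_of_add_eq_zero_right h] at h₂; linarith
  have h₅ : IsSquare ((2 * n : ℤ) : ℚ) ∨ IsSquare ((-(2 * n) : ℤ) : ℚ) := by
    rcases h₃ with h | h
    · left; exact ⟨2 * r.re, by push_cast; rw [h]; ring⟩
    · right; exact ⟨2 * r.re, by push_cast; rw [h]; ring⟩
  obtain ⟨k, rfl⟩ := hn
  rw [Rat.isSquare_intCast_iff, Rat.isSquare_intCast_iff] at h₅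
  have : ∀ t : ZMod 4, t * t ≠ 2 := by decide
  have four : (4 : ZMod 4) = 0 := by decide
  rcases h₅ with ⟨t, ht⟩ | ⟨t, ht⟩
  · apply this t
    have := congrArg (Int.cast : ℤ → ZMod 4) ht
    push_cast at this
    linear_combination -this + k * four
  · apply this t
    have := congrArg (Int.cast : ℤ → ZMod 4) ht
    push_cast at this
    linear_combination -this - (k + 1) * four

/-- The inclusion of `ℤ[i]` in `ℚ(i)`. -/
def ofInt : GaussianInt →+* GaussField := Zsqrtd.lift
  ⟨⟨0, 1⟩, by ext <;> simp [QuadraticAlgebra.re_one, QuadraticAlgebra.im_one]⟩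

lemma ofInt_mk (p q : ℤ) : ofInt ⟨p, q⟩ = ⟨p, q⟩ := by
  ext <;> simp [ofInt]

lemma ofInt_injective : Function.Injective ofInt := by
  rintro ⟨p, q⟩ ⟨r, s⟩ h
  simpa [ofInt_mk, QuadraticAlgebra.ext_iff, Zsqrtd.ext_iff] using h

lemma isIntegral_ofInt (z : GaussianInt) : IsIntegral ℤ (ofInt z) := by
  have hI : IsIntegral ℤ (⟨0, 1⟩ : GaussField) := by
    apply IsIntegral.of_pow two_pos
    have : (⟨0, 1⟩ : GaussField) ^ 2 = ((-1 : ℤ) : GaussField) := by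
      ext <;> simp [sq, QuadraticAlgebra.re_one, QuadraticAlgebra.im_one]
    rw [this]
    exact isIntegral_intCast _
  have : ofInt z = (z.re : GaussField) + (z.im : GaussField) * ⟨0, 1⟩ := rfl
  rw [this]
  exact (isIntegral_intCast _).add ((isIntegral_intCast _).mul hI)

lemma exists_ofInt_eq {z : GaussField} (hz : IsIntegral ℤ z) : ∃ w, ofInt w = z := by
  obtain ⟨h₁, h₂⟩ := QuadraticAlgebra.isIntegral_trace_and_norm hz
  obtain ⟨P, hP⟩ := IsIntegrallyClosed.isIntegral_iff.1 h₁
  obtain ⟨N, hN⟩ := IsIntegrallyClosed.isIntegral_iff.1 h₂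
  have h₃ : IsIntegral ℤ (2 * z.im) := by
    apply IsIntegral.of_pow two_pos
    have : (2 * z.im) ^ 2 = algebraMap ℤ ℚ (4 * N - P ^ 2) := by
      rw [map_sub, map_mul, map_pow, hP, hN]; simp; ring
    rw [this]; exact isIntegral_algebraMap
  obtain ⟨Q, hQ⟩ := IsIntegrallyClosed.isIntegral_iff.1 h₃
  simp only [algebraMap_int_eq, eq_intCast] at hP hQ hN
  have h₄ : P ^ 2 + Q ^ 2 = 4 * N := by
    have : (P : ℚ) ^ 2 + Q ^ 2 = 4 * N := by rw [hP, hQ, hN]; ring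
    exact_mod_cast this
  have h₅ : ∀ x y : ZMod 4, x ^ 2 + y ^ 2 = 0 → 2 * x = 0 ∧ 2 * y = 0 := by decide
  obtain ⟨h₆, h₇⟩ := h₅ P Q (by
    have := congrArg (Int.cast : ℤ → ZMod 4) h₄
    push_cast at this
    rw [this, show (4 : ZMod 4) = 0 by decide, zero_mul])
  have key : ∀ x : ℤ, 2 * (x : ZMod 4) = 0 → ∃ y, x = 2 * y := by
    intro x hx
    obtain ⟨y, hy⟩ := (ZMod.intCast_zmod_eq_zero_iff_dvd (2 * x) 4).1 (by push_cast; exact hx)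
    exact ⟨y, by push_cast at hy; linarith⟩
  obtain ⟨p, rfl⟩ := key P h₆
  obtain ⟨q, rfl⟩ := key Q h₇
  refine ⟨⟨p, q⟩, ?_⟩
  push_cast at hP hQ
  rw [ofInt_mk]
  ext <;> simp <;> linarith

end GaussField

namespace GaussianInt

lemma intCast_dvd_of_dvd_sq {n : ℤ} (hn : Odd n) (hsq : Squarefree n) {w : GaussianInt}
    (h : (n : GaussianInt) ∣ w ^ 2) : (n : GaussianInt) ∣ w := by
  rw [Zsqrtd.intCast_dvd] at h ⊢
  obtain ⟨h₁, h₂⟩ := h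
  simp only [sq, Zsqrtd.re_mul, Zsqrtd.im_mul] at h₁ h₂
  have h₃ : n ∣ w.re * w.im := by
    have h₄ : n ∣ 2 * (w.re * w.im) := by convert h₂ using 1; ring
    exact IsCoprime.dvd_of_dvd_mul_left (Int.isCoprime_iff_gcd_eq_one.2 (by
      obtain ⟨k, rfl⟩ := hn
      simp)) h₄
  constructor
  · rw [← hsq.dvd_pow_iff_dvd three_ne_zero]
    have : w.re ^ 3 = (w.re * w.re + -1 * w.im * w.im) * w.re + w.re * w.im * w.im := by ring
    rw [this]
    exact (h₁.mul_right _).add (h₃.mul_right _)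
  · rw [← hsq.dvd_pow_iff_dvd three_ne_zero]
    have : w.im ^ 3 = w.re * w.im * w.re - (w.re * w.re + -1 * w.im * w.im) * w.im := by ring
    rw [this]
    exact (h₃.mul_right _).sub (h₁.mul_right _)

lemma two_dvd_of_norm_congr {n : ℤ} (hn : Odd n) {u v w : GaussianInt}
    (h : u ^ 2 - I * n * v ^ 2 = 4 * w) : (∃ u', u = 2 * u') ∧ ∃ v', v = 2 * v' := by
  have h₁ := congrArg Zsqrtd.re h
  have h₂ := congrArg Zsqrtd.im h
  simp [sq, I] at h₁ h₂
  have key : ∀ n p q r t : ZMod 4, 2 * n = 2 → p * p + -(q * q) + n * (r * t + t * r) = 0 →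
      p * q + q * p - n * (r * r + -(t * t)) = 0 → 2 * p = 0 ∧ 2 * q = 0 ∧ 2 * r = 0 ∧ 2 * t = 0 := by
    decide
  have key₂ : ∀ x : ℤ, 2 * (x : ZMod 4) = 0 → (2 : ℤ) ∣ x := by
    intro x hx
    obtain ⟨y, hy⟩ := (ZMod.intCast_zmod_eq_zero_iff_dvd (2 * x) 4).1 (by push_cast; exact hx)
    exact ⟨y, by push_cast at hy; linarith⟩
  have four : (4 : ZMod 4) = 0 := by decide
  have e₁ := congrArg (Int.cast : ℤ → ZMod 4) h₁
  have e₂ := congrArg (Int.cast : ℤ → ZMod 4) h₂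
  push_cast at e₁ e₂
  rw [four, zero_mul] at e₁ e₂
  obtain ⟨hp, hq, hr, ht⟩ := key n u.re u.im v.re v.im (by
    obtain ⟨k, rfl⟩ := hn
    push_cast
    linear_combination k * four) (by linear_combination e₁) (by linear_combination e₂)
  have key₃ : ∀ z : GaussianInt, 2 ∣ z.re → 2 ∣ z.im → ∃ z', z = 2 * z' := by
    intro z hr hi
    have := (Zsqrtd.intCast_dvd 2 z).2 ⟨hr, hi⟩
    exact_mod_cast this
  exact ⟨key₃ u (key₂ _ hp) (key₂ _ hq), key₃ v (key₂ _ hr) (key₂ _ ht)⟩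

end GaussianInt

open GaussianInt GaussField

/-- `ℚ(i, φ)` with `φ ^ 2 = i n`. -/
abbrev BiquadField (n : ℤ) := QuadraticAlgebra GaussField ⟨0, n⟩ 0

namespace BiquadField

lemma mk_eq (n : ℤ) : (⟨0, n⟩ : GaussField) = ofInt (I * n) := by
  have : I * n = ⟨0, n⟩ := by ext <;> simp [I]
  rw [this, ofInt_mk]
  simp

lemma exists_ofInt_eq {n : ℤ} (hn : Odd n) (hsq : Squarefree n) {z : BiquadField n}
    (hz : IsIntegral ℤ z) : ∃ u v, z = ⟨ofInt u, ofInt v⟩ := by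
  have n0 : ofInt n ≠ 0 := by
    rw [map_ne_zero_iff _ ofInt_injective]
    exact_mod_cast hsq.ne_zero
  obtain ⟨x, y⟩ := z
  obtain ⟨h₁, h₂⟩ := QuadraticAlgebra.isIntegral_trace_and_norm hz
  dsimp only at h₁ h₂
  obtain ⟨U, hU⟩ := GaussField.exists_ofInt_eq h₁
  obtain ⟨N, hN⟩ := GaussField.exists_ofInt_eq h₂
  have hI : ofInt I * ofInt I = -1 := by rw [← map_mul, I_mul_I, map_neg, map_one]
  rw [mk_eq, map_mul] at hN
  have h₃ : (ofInt n * (2 * y)) ^ 2 = ofInt (n * (-I * (U ^ 2 - 4 * N))) := by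
    simp only [map_mul, map_neg, map_sub, map_pow, map_ofNat, hU, hN]
    linear_combination 4 * (ofInt n) ^ 2 * y ^ 2 * hI
  obtain ⟨W, hW⟩ := GaussField.exists_ofInt_eq
    (IsIntegral.of_pow two_pos (h₃ ▸ isIntegral_ofInt _) : IsIntegral ℤ (ofInt n * (2 * y)))
  have h₄ : W ^ 2 = n * (-I * (U ^ 2 - 4 * N)) := by
    apply ofInt_injective
    rw [map_pow, hW, h₃]
  obtain ⟨V, rfl⟩ := intCast_dvd_of_dvd_sq hn hsq ⟨_, h₄⟩
  rw [map_mul] at hW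
  have hV := mul_left_cancel₀ n0 hW
  obtain ⟨⟨u, rfl⟩, ⟨v, rfl⟩⟩ := two_dvd_of_norm_congr hn (u := U) (v := V) (w := N) (by
    apply ofInt_injective
    simp only [map_mul, map_sub, map_pow, map_ofNat, hU, hN, hV]
    ring)
  rw [map_mul, map_ofNat] at hU hV
  refine ⟨u, v, ?_⟩
  congr 1
  · exact (mul_left_cancel₀ two_ne_zero hU).symm
  · exact (mul_left_cancel₀ two_ne_zero hV).symm

lemma not_sq {n : ℤ} (hn : Odd n) (r : BiquadField n) :
    r ^ 2 ≠ (⟨0, ⟨1, -1⟩⟩ : BiquadField n) + 0 * r := by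
  intro h
  have h₁ := congrArg QuadraticAlgebra.re h
  have h₂ := congrArg QuadraticAlgebra.im h
  simp only [sq, QuadraticAlgebra.re_mul, QuadraticAlgebra.im_mul, zero_mul, add_zero] at h₁ h₂
  have h₀ : r.im ≠ 0 := by
    intro h₃
    have := congrArg QuadraticAlgebra.re h₂
    simp [h₃] at this
  apply GaussField.not_sq hn (⟨0, 1⟩ * r.re / r.im)
  have hI : (⟨0, 1⟩ : GaussField) ^ 2 = -1 := by
    ext <;> simp [sq, QuadraticAlgebra.re_one, QuadraticAlgebra.im_one]
  rw [div_pow, mul_pow, hI, zero_mul, add_zero, div_eq_iff (pow_ne_zero 2 h₀)]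
  linear_combination -h₁

end BiquadField

/-- `ℚ(i, φ, θ)` with `φ ^ 2 = i n` and `θ ^ 2 = (1 - i) φ`. -/
abbrev OctField (n : ℤ) := QuadraticAlgebra (BiquadField n) ⟨0, ⟨1, -1⟩⟩ 0

instance (n : ℤ) [hn : Fact (Odd n)] :
    Fact (∀ r : GaussField, r ^ 2 ≠ (⟨0, n⟩ : GaussField) + 0 * r) := ⟨GaussField.not_sq hn.out⟩

instance (n : ℤ) [hn : Fact (Odd n)] :
    Fact (∀ r : BiquadField n, r ^ 2 ≠ (⟨0, ⟨1, -1⟩⟩ : BiquadField n) + 0 * r) :=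
  ⟨BiquadField.not_sq hn.out⟩

namespace GaussField

lemma ofInt_I_mul : ofInt I * ofInt I = -1 := by rw [← map_mul, I_mul_I, map_neg, map_one]

lemma mk_one_neg_one : (⟨1, -1⟩ : GaussField) = 1 - ofInt I := by
  have : (1 - I : GaussianInt) = ⟨1, -1⟩ := by decide
  rw [← map_one ofInt, ← map_sub, this, ofInt_mk]
  simp

lemma half_mul : (⟨1 / 2, 1 / 2⟩ : GaussField) * (1 - ofInt I) = 1 := by
  rw [← mk_one_neg_one]
  ext <;> norm_num [QuadraticAlgebra.re_one, QuadraticAlgebra.im_one]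

end GaussField

namespace BiquadField

lemma isIntegral_mk {n : ℤ} (u v : GaussianInt) :
    IsIntegral ℤ (⟨ofInt u, ofInt v⟩ : BiquadField n) := by
  have h (w : GaussianInt) : IsIntegral ℤ (⟨ofInt w, 0⟩ : BiquadField n) :=
    map_isIntegral_int (algebraMap GaussField (BiquadField n)) (isIntegral_ofInt w)
  have hφ : IsIntegral ℤ (⟨0, 1⟩ : BiquadField n) := by
    apply IsIntegral.of_pow two_pos
    convert h (I * n) using 1
    rw [sq, ← mk_eq]
    simp
  convert (h u).add ((h v).mul hφ) using 1
  ext1 <;> simp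

end BiquadField

namespace OctField

lemma exists_ofInt_eq {n : ℤ} (hn : Odd n) (hsq : Squarefree n) {z : OctField n}
    (hz : IsIntegral ℤ z) : ∃ p q c d, z = ⟨⟨ofInt p, ofInt q⟩,
      ⟨⟨1 / 2, 1 / 2⟩ * ofInt c + ofInt d, ⟨1 / 2, 1 / 2⟩ * ofInt c⟩⟩ := by
  obtain ⟨⟨a₀, a₁⟩, ⟨b₀, b₁⟩⟩ := z
  have n0 : ofInt n ≠ 0 := by
    rw [map_ne_zero_iff _ ofInt_injective]
    exact_mod_cast hsq.ne_zero
  have π0 : 1 - ofInt I ≠ 0 := right_ne_zero_of_mul_eq_one half_mul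
  have hI := ofInt_I_mul
  obtain ⟨h₁, h₂⟩ := QuadraticAlgebra.isIntegral_trace_and_norm hz
  dsimp only at h₁ h₂
  obtain ⟨A₀, A₁, hA⟩ := BiquadField.exists_ofInt_eq hn hsq h₁
  obtain ⟨N₀, N₁, hN⟩ := BiquadField.exists_ofInt_eq hn hsq h₂
  have h₃ : IsIntegral ℤ ((⟨0, ⟨1, -1⟩⟩ : BiquadField n) * (2 * ⟨b₀, b₁⟩)) := by
    apply IsIntegral.of_pow two_pos
    have hs : IsIntegral ℤ (⟨0, ⟨1, -1⟩⟩ : BiquadField n) := by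
      have := BiquadField.isIntegral_mk (n := n) 0 (1 - I)
      rwa [map_zero, map_sub, map_one, ← mk_one_neg_one] at this
    convert hs.mul ((h₁.pow 2).sub ((isIntegral_intCast 4).mul h₂)) using 1
    push_cast
    ring
  obtain ⟨e₀, e₁, he⟩ := BiquadField.exists_ofInt_eq hn hsq h₃
  have A₀' := congrArg QuadraticAlgebra.re hA
  have A₁' := congrArg QuadraticAlgebra.im hA
  have N₀' := congrArg QuadraticAlgebra.re hN
  have N₁' := congrArg QuadraticAlgebra.im hN
  have e₀' := congrArg QuadraticAlgebra.re he
  have e₁' := congrArg QuadraticAlgebra.im he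
  simp only [sq, two_mul, QuadraticAlgebra.re_mul, QuadraticAlgebra.im_mul, QuadraticAlgebra.re_sub,
    QuadraticAlgebra.im_sub, QuadraticAlgebra.re_add, QuadraticAlgebra.im_add, zero_mul, add_zero,
    zero_add, BiquadField.mk_eq, mk_one_neg_one, map_mul] at A₀' A₁' N₀' N₁' e₀' e₁'
  clear hA hN he h₁ h₂ h₃ hz
  have h₄ : e₀ ^ 2 = n * (I * (1 - I) * (2 * A₀ * A₁ - 4 * N₁) - I * e₁ ^ 2) := by
    apply ofInt_injective
    simp only [map_mul, map_sub, map_pow, map_ofNat, map_one, ← A₀', ← A₁', ← N₁', ← e₀', ← e₁']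
    ring
  obtain ⟨e, rfl⟩ := intCast_dvd_of_dvd_sq hn hsq ⟨_, h₄⟩
  have h₅ : ofInt (-I * e) = 2 * (1 - ofInt I) * b₁ := by
    apply mul_left_cancel₀ n0
    rw [map_mul] at e₀'
    rw [map_mul, map_neg]
    linear_combination ofInt I * e₀' - 2 * ofInt n * (1 - ofInt I) * b₁ * hI
  obtain ⟨p, q, c, d, rfl, rfl, h₆, h₇⟩ := two_dvd_of_congr hn (a₀ := A₀) (a₁ := A₁) (b₀ := e₁)
    (b₁ := -I * e) (r := N₀) (s := N₁)
    (by
      apply ofInt_injective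
      rw [map_sub, map_mul _ _ (-I * e), h₅]
      simp only [map_mul, map_sub, map_add, map_pow, map_ofNat, map_one, ← A₀', ← A₁', ← N₀', ← e₁']
      ring)
    (by
      apply ofInt_injective
      rw [map_sub, map_add ofInt (e₁ ^ 2), map_mul ofInt (I * n) ((-I * e) ^ 2), map_pow _ (-I * e), h₅]
      simp only [map_mul, map_sub, map_pow, map_ofNat, map_one, ← A₀', ← A₁', ← N₁', ← e₁']
      ring)
  rw [h₇, map_mul, map_ofNat] at h₅
  rw [h₆] at e₁'
  simp only [map_mul, map_ofNat, map_add, map_sub, map_one] at A₀' A₁' e₁'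
  refine ⟨p, q, c, d, ?_⟩
  have two : (2 : GaussField) ≠ 0 := two_ne_zero
  have E₁ : b₁ = ⟨1 / 2, 1 / 2⟩ * ofInt c := by
    apply mul_left_cancel₀ (mul_ne_zero two π0)
    linear_combination -h₅ - 2 * ofInt c * half_mul
  congr 2
  · apply mul_left_cancel₀ two
    linear_combination A₀'
  · apply mul_left_cancel₀ two
    linear_combination A₁'
  · apply mul_left_cancel₀ (mul_ne_zero two π0)
    linear_combination e₁' - 2 * ofInt c * half_mul

end OctField

lemma GaussField.trace_eq (z : GaussField) : Algebra.trace ℚ GaussField z = 2 * z.re := by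
  rw [← QuadraticAlgebra.trace_eq_two_mul_re]
  congr!

namespace OctField

variable {n : ℤ} [hn : Fact (Odd n)]

instance : FiniteDimensional ℚ GaussField := by
  have := QuadraticAlgebra.instFinite (-1 : ℚ) 0
  convert this

instance : FiniteDimensional ℚ (BiquadField n) := .trans _ GaussField _

instance : NumberField (OctField n) where
  to_charZero := inferInstance
  to_finiteDimensional := .trans _ (BiquadField n) _

lemma trace_eq (z : OctField n) : Algebra.trace ℚ (OctField n) z = 8 * z.re.re.re := by
  rw [← Algebra.trace_trace (S := BiquadField n), QuadraticAlgebra.trace_eq_two_mul_re,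
    ← Algebra.trace_trace (S := GaussField), QuadraticAlgebra.trace_eq_two_mul_re,
    GaussField.trace_eq]
  simp only [two_mul, QuadraticAlgebra.re_add]
  ring

/-- A `ℤ`-basis of the ring of integers. -/
def intBasis (n : ℤ) : Fin 4 ⊕ Fin 4 → OctField n :=
  Sum.elim
    ![⟨⟨⟨1, 0⟩, 0⟩, 0⟩, ⟨⟨⟨0, 1⟩, 0⟩, 0⟩, ⟨⟨0, ⟨1, 0⟩⟩, 0⟩, ⟨⟨0, ⟨0, 1⟩⟩, 0⟩]
    ![⟨0, ⟨⟨1, 0⟩, 0⟩⟩, ⟨0, ⟨⟨0, 1⟩, 0⟩⟩, ⟨0, ⟨⟨1 / 2, 1 / 2⟩, ⟨1 / 2, 1 / 2⟩⟩⟩,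
      ⟨0, ⟨⟨-1 / 2, 1 / 2⟩, ⟨-1 / 2, 1 / 2⟩⟩⟩]

lemma discr_intBasis : Algebra.discr ℚ (intBasis n) = 2 ^ 24 * n ^ 6 := by
  have : Algebra.traceMatrix ℚ (intBasis n) = Matrix.fromBlocks
    !![8, 0, 0, 0; 0, -8, 0, 0; 0, 0, 0, -8 * (n : ℚ); 0, 0, -8 * (n : ℚ), 0] 0 0
    !![0, 0, 0, -8 * (n : ℚ); 0, 0, -8 * (n : ℚ), 0;
      0, -8 * (n : ℚ), -8 * (n : ℚ), -8 * (n : ℚ); -8 * (n : ℚ), 0, -8 * (n : ℚ), 8 * (n : ℚ)] := by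
    ext i j
    rw [Algebra.traceMatrix_apply, Algebra.traceForm_apply, trace_eq]
    rcases i with i | i <;> rcases j with j | j <;> fin_cases i <;> fin_cases j <;>
      simp [intBasis]
    all_goals ring
  rw [Algebra.discr_def, this, Matrix.det_fromBlocks_zero₂₁]
  simp [Matrix.det_succ_row_zero, Fin.sum_univ_succ, Fin.succAbove]
  ring

end OctField

lemma NumberField.intCast_discr {K ι : Type*} [Field K] [NumberField K] [Fintype ι] [DecidableEq ι]
    (w : ι → 𝓞 K) : (Algebra.discr ℤ w : ℚ) = Algebra.discr ℚ fun i => (w i : K) := by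
  rw [Algebra.discr_def, Algebra.discr_def, ← eq_intCast (Int.castRingHom ℚ), RingHom.map_det]
  congr 1
  ext i j
  rw [RingHom.mapMatrix_apply, Matrix.map_apply, Algebra.traceMatrix_apply,
    Algebra.traceMatrix_apply, Algebra.traceForm_apply, Algebra.traceForm_apply, eq_intCast,
    Algebra.coe_trace_int]
  rfl

lemma NumberField.RingOfIntegers.mem_span_range {K ι : Type*} [Field K] [Fintype ι] (w : ι → 𝓞 K)
    {z : 𝓞 K} {c : ι → ℤ} (h : (z : K) = ∑ i, c i • (w i : K)) :
    z ∈ Submodule.span ℤ (Set.range w) := by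
  refine (Submodule.mem_span_range_iff_exists_fun ℤ).2 ⟨c, RingOfIntegers.ext (Eq.trans ?_ h.symm)⟩
  refine (map_sum (algebraMap (𝓞 K) K) _ _).trans (Finset.sum_congr rfl fun i _ => ?_)
  rw [map_zsmul]

namespace OctField

variable {n : ℤ}

lemma isIntegral_intBasis (hn : Odd n) (i) : IsIntegral ℤ (intBasis n i) := by
  have h (u v : GaussianInt) : IsIntegral ℤ (⟨⟨ofInt u, ofInt v⟩, 0⟩ : OctField n) :=
    map_isIntegral_int (algebraMap (BiquadField n) (OctField n)) (BiquadField.isIntegral_mk u v)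
  have h' (p q r s : ℤ) : IsIntegral ℤ (⟨⟨⟨p, q⟩, ⟨r, s⟩⟩, 0⟩ : OctField n) := by
    simpa only [ofInt_mk] using h ⟨p, q⟩ ⟨r, s⟩
  have hI : IsIntegral ℤ (⟨⟨⟨0, 1⟩, 0⟩, 0⟩ : OctField n) := by
    convert h' 0 1 0 0 using 3 <;> [simp; (simp; rfl)]
  have hθ : IsIntegral ℤ (⟨0, 1⟩ : OctField n) := by
    apply IsIntegral.of_pow two_pos
    convert h' 0 0 1 (-1) using 1
    rw [sq]
    ext <;> simp
  have hψ : IsIntegral ℤ (⟨0, ⟨⟨1 / 2, 1 / 2⟩, ⟨1 / 2, 1 / 2⟩⟩⟩ : OctField n) := by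
    apply IsIntegral.of_pow two_pos
    obtain ⟨k, rfl⟩ := hn
    convert h' (-(2 * k + 1)) (2 * k + 1) (-k) (1 + k) using 1
    rw [sq]
    ext <;> simp <;> ring
  rcases i with i | i <;> fin_cases i
  · exact isIntegral_one
  · exact hI
  · convert h' 0 0 1 0 using 3 <;> simp <;> rfl
  · convert h' 0 0 0 1 using 3 <;> simp <;> rfl
  · exact hθ
  · convert hI.mul hθ using 1
    ext <;> simp [intBasis]
  · exact hψ
  · convert hI.mul hψ using 1
    ext <;> simp [intBasis] <;> ring

lemma exists_eq_sum (hn : Odd n) (hsq : Squarefree n) {z : OctField n} (hz : IsIntegral ℤ z) :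
    ∃ c : Fin 4 ⊕ Fin 4 → ℤ, z = ∑ i, c i • intBasis n i := by
  obtain ⟨p, q, c, d, rfl⟩ := exists_ofInt_eq hn hsq hz
  refine ⟨Sum.elim ![p.re, p.im, q.re, q.im] ![d.re, d.im, c.re, c.im], ?_⟩
  obtain ⟨p, p'⟩ := p
  obtain ⟨q, q'⟩ := q
  obtain ⟨c, c'⟩ := c
  obtain ⟨d, d'⟩ := d
  simp only [ofInt_mk, Fintype.sum_sum_type, Fin.sum_univ_four]
  ext <;> simp [intBasis] <;> ring

variable [hn : Fact (Odd n)]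

theorem discr_eq (hsq : Squarefree n) : discr (OctField n) = 2 ^ 24 * n ^ 6 := by
  let w (i) : 𝓞 (OctField n) := ⟨intBasis n i, isIntegral_intBasis hn.out i⟩
  have hw : Algebra.discr ℤ w = 2 ^ 24 * n ^ 6 := by
    have : ((Algebra.discr ℤ w : ℤ) : ℚ) = 2 ^ 24 * n ^ 6 := by
      rw [intCast_discr]
      exact discr_intBasis
    exact_mod_cast this
  have li : LinearIndependent ℤ w := by
    by_contra h
    rw [Algebra.discr_zero_of_not_linearIndependent ℤ h] at hw
    have := hsq.ne_zero
    simp_all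
  have sp : ⊤ ≤ Submodule.span ℤ (Set.range w) := by
    intro z _
    obtain ⟨c, hc⟩ := exists_eq_sum hn.out hsq z.isIntegral_coe
    exact RingOfIntegers.mem_span_range w hc
  rw [← hw, ← discr_eq_discr _ (Module.Basis.mk li sp), Module.Basis.coe_mk]

end OctField

namespace QuadraticAlgebra

lemma exists_ringHom {R S : Type*} [CommRing R] [CommRing S] {a : R} (f : R →+* S) (u : S)
    (h : u * u = f a) :
    ∃ g : QuadraticAlgebra R a 0 →+* S, ∀ z, g z = f z.re + f z.im * u := by
  let := f.toAlgebra
  refine ⟨(lift ⟨u, ?_⟩ : QuadraticAlgebra R a 0 →ₐ[R] S), fun z => ?_⟩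
  · rw [h, zero_smul, add_zero, Algebra.smul_def, mul_one]
    rfl
  · simp [lift, Algebra.smul_def, RingHom.algebraMap_toAlgebra]

end QuadraticAlgebra

lemma theta_pow_four (m : ℕ) : theta m ^ 4 = m := by
  rw [theta, ← Complex.ofReal_pow, ← Real.rpow_natCast, ← Real.rpow_mul m.cast_nonneg]
  norm_num

namespace OctField

lemma exists_algHom {n : ℤ} {t : ℂ} (ht : t ^ 4 = 2 * n) :
    ∃ f : OctField n →+* ℂ, ∀ z, f z =
      (z.re.re.re + z.re.re.im * Complex.I) +
      (z.re.im.re + z.re.im.im * Complex.I) * ((1 + Complex.I) / 2 * t ^ 2) +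
      ((z.im.re.re + z.im.re.im * Complex.I) +
      (z.im.im.re + z.im.im.im * Complex.I) * ((1 + Complex.I) / 2 * t ^ 2)) * t := by
  have hI := Complex.I_mul_I
  obtain ⟨f, hf⟩ := QuadraticAlgebra.exists_ringHom (a := -1) (algebraMap ℚ ℂ) Complex.I
    (by simp)
  obtain ⟨g, hg⟩ := QuadraticAlgebra.exists_ringHom (a := (⟨0, n⟩ : GaussField)) f
    ((1 + Complex.I) / 2 * t ^ 2) (by
      rw [hf]
      simp only [map_zero, map_intCast]
      linear_combination (1 + Complex.I) ^ 2 / 4 * ht + n / 2 * hI)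
  obtain ⟨h, hh⟩ := QuadraticAlgebra.exists_ringHom (a := (⟨0, ⟨1, -1⟩⟩ : BiquadField n)) g t (by
      rw [hg, hf, hf]
      simp
      linear_combination t ^ 2 / 2 * hI)
  refine ⟨h, fun z => ?_⟩
  simp only [hh, hg, hf, eq_ratCast]

lemma nonempty_algEquiv {n : ℤ} [Fact (Odd n)] {m : ℕ} (h : (m : ℤ) = 2 * n) :
    Nonempty (OctField n ≃ₐ[ℚ] Kfield m) := by
  obtain ⟨f, hf⟩ := exists_algHom (n := n) (t := theta m) (by
    rw [theta_pow_four]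
    exact_mod_cast h)
  let F : OctField n →ₐ[ℚ] ℂ := f.toRatAlgHom
  have hF : F.fieldRange = Kfield m := by
    have hI : Complex.I ∈ Kfield m := IntermediateField.subset_adjoin _ _ (by simp)
    have ht : theta m ∈ Kfield m := IntermediateField.subset_adjoin _ _ (by simp)
    apply le_antisymm
    · rintro _ ⟨z, rfl⟩
      change f z ∈ _
      rw [hf]
      have hq (p q : ℚ) : (p + q * Complex.I : ℂ) ∈ Kfield m :=
        add_mem (SubfieldClass.ratCast_mem _ p) (mul_mem (SubfieldClass.ratCast_mem _ q) hI)
      have hφ : (1 + Complex.I) / 2 * theta m ^ 2 ∈ Kfield m :=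
        mul_mem (div_mem (add_mem (one_mem _) hI) (ofNat_mem _ 2)) (pow_mem ht 2)
      exact add_mem (add_mem (hq _ _) (mul_mem (hq _ _) hφ))
        (mul_mem (add_mem (hq _ _) (mul_mem (hq _ _) hφ)) ht)
    · rw [Kfield, IntermediateField.adjoin_le_iff]
      rintro _ (rfl | rfl)
      · refine ⟨⟨⟨⟨0, 1⟩, 0⟩, 0⟩, ?_⟩
        change f _ = _
        simp [hf]
      · refine ⟨⟨0, ⟨⟨1, 0⟩, 0⟩⟩, ?_⟩
        change f _ = _
        simp [hf]
  exact ⟨(AlgEquiv.ofInjectiveField F).trans (IntermediateField.equivOfEq hF)⟩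

end OctField

/-- For squarefree `m ≡ 2 (mod 4)`, the discriminant of `ℚ(i, m^(1/4))` is `2^18 m^6`. -/
theorem stmt_3 (m : ℕ) (hm : Squarefree m) (hpos : 0 < m) (h2 : m % 4 = 2)
    [NumberField (Kfield m)] :
    NumberField.discr (Kfield m) = 2 ^ 18 * (m : ℤ) ^ 6 := by
  obtain ⟨k, rfl⟩ : ∃ k, m = 2 * (2 * k + 1) := ⟨m / 4, by omega⟩
  have : Fact (Odd ((2 * k + 1 : ℕ) : ℤ)) := ⟨⟨k, by push_cast; rfl⟩⟩
  obtain ⟨e⟩ := OctField.nonempty_algEquiv (n := ((2 * k + 1 : ℕ) : ℤ))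
    (m := 2 * (2 * k + 1)) (by push_cast; rfl)
  rw [← discr_eq_discr_of_algEquiv _ e, OctField.discr_eq
    (Int.squarefree_natCast.2 (hm.squarefree_of_dvd ⟨2, by ring⟩))]
  push_cast
  ring
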